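/- The quantum-graph-walk coin is unitary: let N be a finite nonempty index set with d = |N|, let k be a nonzero real, λ ≥ 0 a real, and for each m ∈ N let L_m and A_m be reals. Then the N×N matrix H with entries H_{m,l} = (2/(d + iλ/k) − δ_{l,m})·e^{iL_m(k − A_m)} is unitary. -/

import Mathlib

open Matrix Complex BigOperators

/-- The local coin of the quantum graph walk at a vertex of degree `d = |N|`:
`H_{m,l} = (2/(d + iλ/k) − δ_{l,m})·e^{iL_m(k − A_m)}`. -/
noncomputable def qgLocalCoin {N : Type*} [Fintype N] [DecidableEq N]
    (k lam : ℝ) (L A : N → ℝ) : Matrix N N ℂ :=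
  fun m l =>
    (2 / ((Fintype.card N : ℂ) + Complex.I * (lam : ℂ) / (k : ℂ)) - if l = m then 1 else 0) *
      Complex.exp (Complex.I * (L m : ℂ) * ((k : ℂ) - (A m : ℂ)))

/-- the quantum-graph-walk coin is unitary: for `N` finite nonempty, `k ≠ 0` real,
`λ ≥ 0` real and reals `L_m, A_m`, the matrix `H_{m,l} = (2/(d + iλ/k) − δ_{l,m})·e^{iL_m(k − A_m)}`
is unitary. -/
theorem qgLocalCoin_unitary {N : Type*} [Fintype N] [DecidableEq N] [Nonempty N]
    (k : ℝ) (hk : k ≠ 0) (lam : ℝ) (hlam : 0 ≤ lam) (L A : N → ℝ) :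
    qgLocalCoin k lam L A ∈ Matrix.unitaryGroup N ℂ := by
  rw [Matrix.mem_unitaryGroup_iff]
  have hd : (0 : ℝ) < (Fintype.card N : ℝ) := by exact_mod_cast Fintype.card_pos
  obtain ⟨z, hz⟩ : ∃ z : ℂ, z = (Fintype.card N : ℂ) + Complex.I * (lam : ℂ) / (k : ℂ) := ⟨_, rfl⟩
  have hz' : z = (Fintype.card N : ℂ) + Complex.I * ((lam / k : ℝ) : ℂ) := by
    rw [hz]; push_cast; ring
  have hconj : star z = (Fintype.card N : ℂ) - Complex.I * ((lam / k : ℝ) : ℂ) := by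
    rw [hz']
    simp only [Complex.star_def, map_add, map_mul, Complex.conj_I, Complex.conj_ofReal,
      map_natCast]
    ring
  have hz0 : z ≠ 0 := by
    intro h
    have h1 : z + star z = 0 := by rw [h]; simp
    rw [hconj, hz'] at h1
    have h2 : (Fintype.card N : ℂ) = 0 := by linear_combination h1 / 2
    have h3 : (Fintype.card N : ℝ) = 0 := by exact_mod_cast h2
    exact hd.ne' h3
  have hs0 : star z ≠ 0 := star_ne_zero.mpr hz0
  have hsum : z + star z = 2 * (Fintype.card N : ℂ) := by
    rw [hconj, hz']; ring
  have key : (Fintype.card N : ℂ) * ((2 / z) * (2 / star z)) = 2 / z + 2 / star z := by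
    field_simp
    linear_combination -hsum
  have hexp : ∀ m : N, Complex.exp (Complex.I * (L m : ℂ) * ((k : ℂ) - (A m : ℂ))) *
      star (Complex.exp (Complex.I * (L m : ℂ) * ((k : ℂ) - (A m : ℂ)))) = 1 := by
    intro m
    rw [Complex.star_def, ← Complex.exp_conj, ← Complex.exp_add]
    simp only [map_sub, map_mul, Complex.conj_I, Complex.conj_ofReal]
    rw [← Complex.exp_zero]
    congr 1
    ring
  ext m n
  rw [Matrix.mul_apply]
  simp only [Matrix.star_apply, qgLocalCoin, ← hz]
  generalize hE : (fun m : N => Complex.exp (Complex.I * (L m : ℂ) * ((k : ℂ) - (A m : ℂ)))) = E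
  have hE' : ∀ m : N, Complex.exp (Complex.I * (L m : ℂ) * ((k : ℂ) - (A m : ℂ))) = E m := by
    intro m; rw [← hE]
  simp only [hE'] at hexp ⊢
  have hterm : ∀ l : N, (2 / z - if l = m then 1 else 0) * E m *
      star ((2 / z - if l = n then 1 else 0) * E n) =
      ((2 / z) * (2 / star z) - (if l = m then 2 / star z else 0) - (if l = n then 2 / z else 0)
        + (if l = m then (if l = n then 1 else 0) else 0)) * (E m * star (E n)) := by
    intro l
    have h2 : star (2 / z) = 2 / star z := by simp
    rw [star_mul', star_sub, h2]
    split_ifs <;> simp <;> ring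
  rw [Finset.sum_congr rfl fun l _ => hterm l, ← Finset.sum_mul]
  simp only [Finset.sum_add_distrib, Finset.sum_sub_distrib, Finset.sum_const, Finset.card_univ,
    nsmul_eq_mul, Finset.sum_ite_eq', Finset.mem_univ, if_true, key, Matrix.one_apply]
  by_cases h : m = n
  · subst h
    rw [hexp]; simp
  · simp [h]
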